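/- Let Π be a closed and strictly positive set of distributions on {0,1}^p, let r be a quota rule and f a logical connection, and suppose condition κ4 holds. Then there exists a constant C > 0, depending only on Π, q, d, and f, such that for every n ≥ 1, DP^min(n) ≤ C·n^{−1/2}. -/

import Mathlib

/-- A judgement on `p` premises: a vector in `{0,1}^p`, encoded as `Fin p → Bool`. -/
abbrev Judg (p : ℕ) : Type := Fin p → Bool

noncomputable section

/-- `Ω_i`: for a premise index `i < p`, the set of judgements whose `i`-th premise is `1`;
for the conclusion index `i = p`, the set of judgements `ω` with `f ω = 1`. -/
def Omega (p : ℕ) (f : Judg p → Bool) (i : Fin (p + 1)) : Finset (Judg p) :=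
  if h : (i : ℕ) < p then Finset.univ.filter (fun ω => ω ⟨(i : ℕ), h⟩ = true)
  else Finset.univ.filter (fun ω => f ω = true)

/-- The vector `c_i ∈ ℝ^({0,1}^p)`: `c_i(ω) = q_i - 1` if `ω ∈ Ω_i`, else `q_i`. -/
def cvec (p : ℕ) (f : Judg p → Bool) (q : Fin (p + 1) → ℝ) (i : Fin (p + 1)) :
    Judg p → ℝ :=
  fun ω => if ω ∈ Omega p f i then q i - 1 else q i

/-- Euclidean inner product on `ℝ^({0,1}^p)`. -/
def inn (p : ℕ) (u v : Judg p → ℝ) : ℝ := ∑ ω : Judg p, u ω * v ω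

/-- The histogram of a profile: how many agents cast each judgement. -/
def Hist (p n : ℕ) (P : Fin n → Judg p) (ω : Judg p) : ℕ :=
  (Finset.univ.filter (fun j => P j = ω)).card

/-- The histogram, viewed as a vector in `ℝ^({0,1}^p)`. -/
def HistR (p n : ℕ) (P : Fin n → Judg p) : Judg p → ℝ :=
  fun ω => (Hist p n P ω : ℝ)

/-- `n_i(P)`: the number of agents of `P` whose judgement lies in `Ω_i`. -/
def nOnes (p n : ℕ) (f : Judg p → Bool) (P : Fin n → Judg p) (i : Fin (p + 1)) : ℕ :=
  ∑ ω ∈ Omega p f i, Hist p n P ω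

/-- The quota rule on profiles, with thresholds `q` and tie-breakings `d`. -/
def quota (p n : ℕ) (f : Judg p → Bool) (q : Fin (p + 1) → ℝ) (d : Fin (p + 1) → Bool)
    (P : Fin n → Judg p) (i : Fin (p + 1)) : Bool := by
  classical
  exact if (nOnes p n f P i : ℝ) > q i * (n : ℝ) then true
    else if (nOnes p n f P i : ℝ) = q i * (n : ℝ) then d i
    else false

/-- The real value of a bit: `1` for `1`/true, `0` for `0`/false. -/
def bval (b : Bool) : ℝ := if b then 1 else 0

/-- `sign(1) = 1` and `sign(0) = -1`. -/
def sgn (b : Bool) : ℝ := if b then 1 else -1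

/-- `α ∈ {0,1}^{p+1}` is consistent if its conclusion component equals `f` applied to
its premise components. -/
def Consistent (p : ℕ) (f : Judg p → Bool) (α : Fin (p + 1) → Bool) : Prop :=
  α (Fin.last p) = f (fun j => α j.castSucc)

/-- A profile is a doctrinal paradox if the quota-rule output is inconsistent. -/
def Paradox (p n : ℕ) (f : Judg p → Bool) (q : Fin (p + 1) → ℝ) (d : Fin (p + 1) → Bool)
    (P : Fin n → Judg p) : Prop :=
  ¬ Consistent p f (quota p n f q d P)

/-- The polyhedron `H_α`. -/
def polyH (p : ℕ) (f : Judg p → Bool) (q : Fin (p + 1) → ℝ) (d : Fin (p + 1) → Bool)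
    (α : Fin (p + 1) → Bool) : Set (Judg p → ℝ) :=
  {x | ∀ i : Fin (p + 1),
    sgn (α i) * inn p (cvec p f q i) x ≤ sgn (α i) * bval (d i) - bval (α i)}

/-- The characteristic cone `H_{α,≤0}`. -/
def coneH (p : ℕ) (f : Judg p → Bool) (q : Fin (p + 1) → ℝ)
    (α : Fin (p + 1) → Bool) : Set (Judg p → ℝ) :=
  {x | ∀ i : Fin (p + 1), sgn (α i) * inn p (cvec p f q i) x ≤ 0}

/-- A probability distribution on `{0,1}^p`. -/
def IsDistribution (p : ℕ) (π : Judg p → ℝ) : Prop :=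
  (∀ ω, 0 ≤ π ω) ∧ ∑ ω : Judg p, π ω = 1

/-- `pr_i(π) = Σ_{ω ∈ Ω_i} π(ω)`. -/
def pr (p : ℕ) (f : Judg p → Bool) (π : Judg p → ℝ) (i : Fin (p + 1)) : ℝ :=
  ∑ ω ∈ Omega p f i, π ω

/-- The quota rule applied to a distribution. -/
def quotaDist (p : ℕ) (f : Judg p → Bool) (q : Fin (p + 1) → ℝ) (d : Fin (p + 1) → Bool)
    (π : Judg p → ℝ) (i : Fin (p + 1)) : Bool := by
  classical
  exact if pr p f π i > q i then true
    else if pr p f π i = q i then d i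
    else false

/-- `α` is a refinement of `π`: it matches `r(π)` on every non-tied proposition. -/
def Refines (p : ℕ) (f : Judg p → Bool) (q : Fin (p + 1) → ℝ) (d : Fin (p + 1) → Bool)
    (π : Judg p → ℝ) (α : Fin (p + 1) → Bool) : Prop :=
  ∀ i : Fin (p + 1), pr p f π i ≠ q i → α i = quotaDist p f q d π i

/-- `α` is an effective refinement of `π` at `n`: a refinement realized by some profile. -/
def EffRef (p n : ℕ) (f : Judg p → Bool) (q : Fin (p + 1) → ℝ) (d : Fin (p + 1) → Bool)
    (π : Judg p → ℝ) (α : Fin (p + 1) → Bool) : Prop :=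
  Refines p f q d π α ∧ ∃ P : Fin n → Judg p, quota p n f q d P = α

/-- The probability that a random profile drawn from the independent (non-identical)
product of `vπ` is a doctrinal paradox. -/
def probParadox (p n : ℕ) (f : Judg p → Bool) (q : Fin (p + 1) → ℝ)
    (d : Fin (p + 1) → Bool) (vπ : Fin n → Judg p → ℝ) : ℝ := by
  classical
  exact ∑ P : Fin n → Judg p,
    if Paradox p n f q d P then ∏ j : Fin n, vπ j (P j) else 0

/-- The max-smoothed likelihood of the doctrinal paradox. -/
def DPmax (p n : ℕ) (f : Judg p → Bool) (q : Fin (p + 1) → ℝ) (d : Fin (p + 1) → Bool)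
    (D : Set (Judg p → ℝ)) : ℝ :=
  sSup {x : ℝ | ∃ vπ : Fin n → Judg p → ℝ,
    (∀ j, vπ j ∈ D) ∧ x = probParadox p n f q d vπ}

/-- The min-smoothed likelihood of the doctrinal paradox. -/
def DPmin (p n : ℕ) (f : Judg p → Bool) (q : Fin (p + 1) → ℝ) (d : Fin (p + 1) → Bool)
    (D : Set (Judg p → ℝ)) : ℝ :=
  sInf {x : ℝ | ∃ vπ : Fin n → Judg p → ℝ,
    (∀ j, vπ j ∈ D) ∧ x = probParadox p n f q d vπ}

/-- Condition `κ1(n)`: no profile of `n` agents is a doctrinal paradox. -/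
def kappa1 (p n : ℕ) (f : Judg p → Bool) (q : Fin (p + 1) → ℝ)
    (d : Fin (p + 1) → Bool) : Prop :=
  ∀ P : Fin n → Judg p, ¬ Paradox p n f q d P

/-- Condition `κ2(n)`: every effective refinement at `n` of every `π` in the convex hull
of `D` is consistent. -/
def kappa2 (p n : ℕ) (f : Judg p → Bool) (q : Fin (p + 1) → ℝ) (d : Fin (p + 1) → Bool)
    (D : Set (Judg p → ℝ)) : Prop :=
  ∀ π ∈ convexHull ℝ D, ∀ α : Fin (p + 1) → Bool,
    EffRef p n f q d π α → Consistent p f α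

/-- Condition `κ3(n)`: some `π` in the convex hull of `D` has all its effective
refinements at `n` consistent. -/
def kappa3 (p n : ℕ) (f : Judg p → Bool) (q : Fin (p + 1) → ℝ) (d : Fin (p + 1) → Bool)
    (D : Set (Judg p → ℝ)) : Prop :=
  ∃ π ∈ convexHull ℝ D, ∀ α : Fin (p + 1) → Bool,
    EffRef p n f q d π α → Consistent p f α

/-- Condition `κ4`: the conclusion depends on exactly one premise, with matching
thresholds. -/
def kappa4 (p : ℕ) (f : Judg p → Bool) (q : Fin (p + 1) → ℝ) : Prop :=
  ∃ i : Fin p,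
    ((∀ ω : Judg p, f ω = ω i) ∧ q (Fin.last p) = q i.castSucc) ∨
    ((∀ ω : Judg p, f ω = !(ω i)) ∧ q (Fin.last p) = 1 - q i.castSucc)

/-- `D` is strictly positive: some `ε > 0` lower-bounds every probability. -/
def StrictlyPositive (p : ℕ) (D : Set (Judg p → ℝ)) : Prop :=
  ∃ ε > (0 : ℝ), ∀ π ∈ D, ∀ ω : Judg p, ε ≤ π ω

open Polynomial in
/-- The number of successes in `n` independent trials is binomially distributed: the weights
of the profiles with exactly `k` votes in `{ω | s ω}` add up to the binomial probability. -/
theorem sum_prod_ite_card_eq {α : Type*} [Fintype α] (w : α → ℝ) (s : α → Bool) (n k : ℕ) :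
    ∑ P : Fin n → α, (if (Finset.univ.filter (fun j => s (P j) = true)).card = k
        then ∏ j, w (P j) else 0)
      = (n.choose k : ℝ) * (∑ ω, if s ω then w ω else 0) ^ k
          * (∑ ω, if s ω then 0 else w ω) ^ (n - k) := by
  have key : (∑ ω, (C (w ω) * X ^ (if s ω then 1 else 0) : ℝ[X]))
      = C (∑ ω, if s ω then w ω else 0) * X + C (∑ ω, if s ω then 0 else w ω) := by
    rw [map_sum, map_sum, Finset.sum_mul, ← Finset.sum_add_distrib]
    refine Finset.sum_congr rfl fun ω _ => ?_
    by_cases h : s ω <;> simp [h]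
  have hpow := congrArg (fun r : ℝ[X] => (r ^ n).coeff k) key
  rw [Fintype.sum_pow, Polynomial.finsetSum_coeff, add_pow, Polynomial.finsetSum_coeff] at hpow
  have hl : ∀ P : Fin n → α,
      (∏ j, (C (w (P j)) * X ^ (if s (P j) then 1 else 0) : ℝ[X])).coeff k
        = if (Finset.univ.filter (fun j => s (P j) = true)).card = k
            then ∏ j, w (P j) else 0 := by
    intro P
    rw [Finset.prod_mul_distrib, ← map_prod, Finset.prod_pow_eq_pow_sum, coeff_C_mul,
      coeff_X_pow, Finset.card_filter]
    simp only [eq_comm (a := k), mul_ite, mul_one, mul_zero]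
  simp only [hl] at hpow
  rw [hpow]
  have hr : ∀ m : ℕ, ((C (∑ ω, if s ω then w ω else 0) * X : ℝ[X]) ^ m
      * C (∑ ω, if s ω then 0 else w ω) ^ (n - m) * ((n.choose m : ℕ) : ℝ[X])).coeff k
      = if k = m then (n.choose m : ℝ) * (∑ ω, if s ω then w ω else 0) ^ m
          * (∑ ω, if s ω then 0 else w ω) ^ (n - m) else 0 := by
    intro m
    rw [mul_pow, ← C_pow, ← C_pow, ← C_eq_natCast, mul_right_comm (C _), ← C_mul,
      mul_right_comm (C _), ← C_mul, coeff_C_mul, coeff_X_pow]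
    split_ifs <;> ring
  simp only [hr]
  rw [Finset.sum_ite_eq]
  split_ifs with h
  · rfl
  · rw [Nat.choose_eq_zero_of_lt (by simpa [Nat.lt_succ_iff] using h)]
    simp

/-- Successive binomial weights: `(n - k) a b_k = (k + 1) (1 - a) b_{k+1}`. -/
theorem binomial_weight_succ (n k : ℕ) (a : ℝ) :
    ((n : ℝ) - k) * a * ((n.choose k : ℝ) * a ^ k * (1 - a) ^ (n - k))
      = ((k + 1 : ℕ) : ℝ) * (1 - a)
        * ((n.choose (k + 1) : ℝ) * a ^ (k + 1) * (1 - a) ^ (n - (k + 1))) := by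
  rcases lt_trichotomy k n with h | h | h
  · have hc : (n.choose (k + 1) : ℝ) * ((k + 1 : ℕ) : ℝ) = n.choose k * ((n : ℝ) - k) := by
      rw [← Nat.cast_sub h.le]
      exact_mod_cast Nat.choose_succ_right_eq n k
    have hp : (1 - a) ^ (n - k) = (1 - a) ^ (n - (k + 1)) * (1 - a) := by
      rw [← pow_succ]; congr 1; omega
    rw [hp]
    linear_combination (-(a ^ (k + 1) * (1 - a) ^ (n - (k + 1)) * (1 - a))) * hc
  · subst h
    simp
  · rw [Nat.choose_eq_zero_of_lt h, Nat.choose_eq_zero_of_lt (by omega)]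
    simp

/-- The mean absolute deviation of a binomial variable is at most `√n`. -/
theorem binomial_mean_abs_deviation_le {n : ℕ} (hn : 1 ≤ n) {a : ℝ} (h0 : 0 ≤ a) (h1 : a ≤ 1) :
    ∑ j ∈ Finset.range (n + 1),
      |(n : ℝ) * a - j| * ((n.choose j : ℝ) * a ^ j * (1 - a) ^ (n - j)) ≤ √n := by
  have h1a : 0 ≤ 1 - a := by linarith
  have hs : 0 < √(n : ℝ) := Real.sqrt_pos.2 (by exact_mod_cast hn)
  have hss : √(n : ℝ) * √n = n := Real.mul_self_sqrt (by positivity)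
  have hsum : ∑ j ∈ Finset.range (n + 1), (n.choose j : ℝ) * a ^ j * (1 - a) ^ (n - j) = 1 := by
    have h := congrArg (Polynomial.eval a) (bernsteinPolynomial.sum ℝ n)
    simpa [Polynomial.eval_finsetSum, bernsteinPolynomial] using h
  have hvar : ∑ j ∈ Finset.range (n + 1),
      ((n : ℝ) * a - j) ^ 2 * ((n.choose j : ℝ) * a ^ j * (1 - a) ^ (n - j))
        = n * a * (1 - a) := by
    have h := congrArg (Polynomial.eval a) (bernsteinPolynomial.variance ℝ n)
    simpa [Polynomial.eval_finsetSum, bernsteinPolynomial] using h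
  have hstep : 2 * √(n : ℝ) * ∑ j ∈ Finset.range (n + 1),
      |(n : ℝ) * a - j| * ((n.choose j : ℝ) * a ^ j * (1 - a) ^ (n - j))
      ≤ n * a * (1 - a) + n * 1 := by
    refine le_of_le_of_eq ?_ (congrArg₂ (fun x y => x + (n : ℝ) * y) hvar hsum)
    simp only [Finset.mul_sum, ← Finset.sum_add_distrib]
    refine Finset.sum_le_sum fun j _ => ?_
    have hb : 0 ≤ (n.choose j : ℝ) * a ^ j * (1 - a) ^ (n - j) := by positivity
    have hq : 2 * √(n : ℝ) * |(n : ℝ) * a - j| ≤ ((n : ℝ) * a - j) ^ 2 + n := by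
      nlinarith [sq_nonneg (|(n : ℝ) * a - j| - √(n : ℝ)), sq_abs ((n : ℝ) * a - j)]
    nlinarith [mul_le_mul_of_nonneg_right hq hb]
  have ha : a * (1 - a) ≤ 1 := by nlinarith
  have hna : (n : ℝ) * (a * (1 - a)) ≤ n * 1 := by gcongr
  refine le_of_mul_le_mul_left (a := 2 * √(n : ℝ)) ?_ (by positivity)
  nlinarith

/-- An anti-concentration bound: if `ε ≤ a ≤ 1 - ε`, every weight of the binomial distribution
with parameters `n` and `a` is at most `2 / (ε √n)`. -/
theorem binomial_weight_le {n : ℕ} (hn : 1 ≤ n) (k : ℕ) {a ε : ℝ} (hε : 0 < ε)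
    (h0 : ε ≤ a) (h1 : ε ≤ 1 - a) :
    (n.choose k : ℝ) * a ^ k * (1 - a) ^ (n - k) ≤ 2 / ε * (√n)⁻¹ := by
  have ha : 0 ≤ a := by linarith
  have h1a : 0 ≤ 1 - a := by linarith
  have hs : 0 < √(n : ℝ) := Real.sqrt_pos.2 (by exact_mod_cast hn)
  have hss : √(n : ℝ) * √n = n := Real.mul_self_sqrt (by positivity)
  rcases lt_or_ge n k with hk | hk
  · rw [Nat.choose_eq_zero_of_lt hk, Nat.cast_zero, zero_mul, zero_mul]
    positivity
  set b : ℕ → ℝ := fun j => (n.choose j : ℝ) * a ^ j * (1 - a) ^ (n - j) with hb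
  have hb0 : ∀ j, 0 ≤ b j := fun j => by positivity
  have htel : ∀ m : ℕ, (m : ℝ) * (1 - a) * b m
      = ∑ j ∈ Finset.range m, ((n : ℝ) * a - j) * b j := by
    intro m
    induction m with
    | zero => simp
    | succ m ih =>
      rw [Finset.sum_range_succ, ← ih, ← binomial_weight_succ]
      ring
  have hu : ∀ m ≤ n + 1, (m : ℝ) * (1 - a) * b m ≤ √n := by
    intro m hm
    rw [htel]
    refine le_trans ?_ (binomial_mean_abs_deviation_le hn ha (by linarith))
    refine le_trans (Finset.sum_le_sum fun j _ =>
      mul_le_mul_of_nonneg_right (le_abs_self _) (hb0 j)) ?_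
    exact Finset.sum_le_sum_of_subset_of_nonneg (Finset.range_mono hm)
      fun j _ _ => mul_nonneg (abs_nonneg _) (hb0 j)
  have hk1 := hu k (by omega)
  have hk2 : ((n : ℝ) - k) * a * b k ≤ √n :=
    (binomial_weight_succ n k a).trans_le (hu (k + 1) (by omega))
  have hkn : (k : ℝ) ≤ n := by exact_mod_cast hk
  have hlow : (n : ℝ) * ε ≤ k * (1 - a) + (n - k) * a := by
    nlinarith [mul_le_mul_of_nonneg_left h1 (Nat.cast_nonneg (α := ℝ) k),
      mul_le_mul_of_nonneg_left h0 (sub_nonneg.2 hkn)]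
  have hmain : (n : ℝ) * ε * b k ≤ 2 * √n := by
    nlinarith [mul_le_mul_of_nonneg_right hlow (hb0 k)]
  change b k ≤ _
  rw [← div_eq_mul_inv, div_div, le_div_iff₀ (by positivity)]
  refine le_of_mul_le_mul_left (a := √(n : ℝ)) ?_ hs
  calc √(n : ℝ) * (b k * (ε * √n)) = (√(n : ℝ) * √n) * ε * b k := by ring
    _ ≤ √n * 2 := by rw [hss]; linarith

/-- `n_i(P)` counts the agents whose judgement lies in `Ω_i`. -/
theorem nOnes_eq_card (p n : ℕ) (f : Judg p → Bool) (P : Fin n → Judg p) (i : Fin (p + 1)) :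
    nOnes p n f P i = (Finset.univ.filter (fun j => P j ∈ Omega p f i)).card := by
  rw [nOnes, Finset.card_eq_sum_card_fiberwise (f := P) (t := Omega p f i)
    (fun j hj => by simpa using hj)]
  refine Finset.sum_congr rfl fun ω hω => ?_
  rw [Hist, Finset.filter_filter]
  congr 1
  ext j
  simp only [Finset.mem_filter, Finset.mem_univ, true_and]
  exact ⟨fun h => ⟨h ▸ hω, h⟩, fun h => h.2⟩

theorem nOnes_castSucc (p n : ℕ) (f : Judg p → Bool) (P : Fin n → Judg p) (i : Fin p) :
    nOnes p n f P i.castSucc = (Finset.univ.filter (fun j => P j i = true)).card := by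
  rw [nOnes_eq_card]
  simp [Omega]

theorem nOnes_last (p n : ℕ) (f : Judg p → Bool) (P : Fin n → Judg p) :
    nOnes p n f P (Fin.last p) = (Finset.univ.filter (fun j => f (P j) = true)).card := by
  rw [nOnes_eq_card]
  simp [Omega]

/-- Under `κ4`, a doctrinal paradox forces an exact tie on the premise deciding `f`. -/
theorem tie_of_paradox {p n : ℕ} {f : Judg p → Bool} {q : Fin (p + 1) → ℝ}
    {d : Fin (p + 1) → Bool} {i : Fin p}
    (hi : ((∀ ω : Judg p, f ω = ω i) ∧ q (Fin.last p) = q i.castSucc) ∨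
      ((∀ ω : Judg p, f ω = !(ω i)) ∧ q (Fin.last p) = 1 - q i.castSucc))
    {P : Fin n → Judg p} (hP : Paradox p n f q d P) :
    ((Finset.univ.filter (fun j => P j i = true)).card : ℝ) = q i.castSucc * n := by
  by_contra hne
  apply hP
  rcases hi with ⟨hf, hq⟩ | ⟨hf, hq⟩
  · simp [Consistent, quota, nOnes_castSucc, nOnes_last, hf, hq, hne]
  · have hcard : ((Finset.univ.filter (fun j => P j i = false)).card : ℝ)
        = n - (Finset.univ.filter (fun j => P j i = true)).card := by
      have h := Finset.card_filter_add_card_filter_not (s := (Finset.univ : Finset (Fin n)))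
        (fun j => P j i = true)
      simp only [Bool.not_eq_true, Finset.card_univ, Fintype.card_fin] at h
      rw [eq_sub_iff_add_eq, add_comm]
      exact_mod_cast h
    simp only [Consistent, quota, nOnes_castSucc, nOnes_last, hf, hq, Bool.not_eq_true', hcard,
      gt_iff_lt]
    rcases lt_or_gt_of_ne hne with h | h
    · rw [if_pos (by linarith), if_neg (by linarith), if_neg (by linarith)]
      rfl
    · rw [if_neg (by linarith), if_neg (by linarith), if_pos (by linarith)]
      rfl

theorem probParadox_nonneg {p n : ℕ} (f : Judg p → Bool) (q : Fin (p + 1) → ℝ)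
    (d : Fin (p + 1) → Bool) {vπ : Fin n → Judg p → ℝ} (h : ∀ j ω, 0 ≤ vπ j ω) :
    0 ≤ probParadox p n f q d vπ := by
  unfold probParadox
  refine Finset.sum_nonneg fun P _ => ?_
  split_ifs
  · exact Finset.prod_nonneg fun j _ => h j _
  · exact le_rfl

/-- if κ4 holds, there is `C > 0` with `DP^min(n) ≤ C·n^{−1/2}` for all
`n ≥ 1`. -/
theorem stmt_17 (p : ℕ) (hp : 1 ≤ p) (f : Judg p → Bool)
    (q : Fin (p + 1) → ℝ) (hq : ∀ i, q i ∈ Set.Icc (0 : ℝ) 1)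
    (d : Fin (p + 1) → Bool) (D : Set (Judg p → ℝ)) (hne : D.Nonempty)
    (hcl : IsClosed D) (hsp : StrictlyPositive p D)
    (hdist : ∀ π ∈ D, IsDistribution p π) (hk4 : kappa4 p f q) :
    ∃ C > (0 : ℝ), ∀ n : ℕ, 1 ≤ n →
      DPmin p n f q d D ≤ C * (n : ℝ) ^ (-(1 : ℝ) / 2) := by
  obtain ⟨i, hi⟩ := hk4
  obtain ⟨ε, hε, hpos⟩ := hsp
  obtain ⟨π, hπ⟩ := hne
  obtain ⟨hπ0, hπ1⟩ := hdist π hπ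
  refine ⟨2 / ε, by positivity, fun n hn => ?_⟩
  have hrpow : (n : ℝ) ^ (-(1 : ℝ) / 2) = (√n)⁻¹ := by
    rw [neg_div, Real.rpow_neg (by positivity), Real.sqrt_eq_rpow]
  rw [hrpow]
  have hle : DPmin p n f q d D ≤ probParadox p n f q d fun _ => π := by
    refine csInf_le ⟨0, ?_⟩ ⟨fun _ => π, fun _ => hπ, rfl⟩
    rintro x ⟨vπ, hv, rfl⟩
    exact probParadox_nonneg f q d fun j ω => (hdist _ (hv j)).1 ω
  refine hle.trans ?_
  set k : ℕ := ⌊q i.castSucc * n⌋₊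
  have htie : probParadox p n f q d (fun _ => π) ≤
      ∑ P : Fin n → Judg p, (if (Finset.univ.filter (fun j => P j i = true)).card = k
        then ∏ j, π (P j) else 0) := by
    unfold probParadox
    refine Finset.sum_le_sum fun P _ => ?_
    have hprod : 0 ≤ ∏ j, π (P j) := Finset.prod_nonneg fun j _ => hπ0 _
    by_cases hP : Paradox p n f q d P
    · have hk : (Finset.univ.filter (fun j => P j i = true)).card = k := by
        rw [← Nat.floor_natCast (R := ℝ)
          (Finset.univ.filter (fun j => P j i = true)).card, tie_of_paradox hi hP]
      rw [if_pos hP, if_pos hk]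
    · rw [if_neg hP]
      split_ifs
      · exact hprod
      · exact le_rfl
  refine htie.trans ?_
  rw [sum_prod_ite_card_eq π (fun ω => ω i) n k]
  set a : ℝ := ∑ ω : Judg p, if ω i then π ω else 0 with ha
  have hcompl : (∑ ω : Judg p, if ω i then 0 else π ω) = 1 - a := by
    rw [eq_sub_iff_add_eq, ha, ← Finset.sum_add_distrib, ← hπ1]
    refine Finset.sum_congr rfl fun ω _ => ?_
    split_ifs <;> simp
  have hεa : ε ≤ a := by
    refine (hpos π hπ fun _ => true).trans ?_
    have h := Finset.single_le_sum (f := fun ω : Judg p => if ω i then π ω else 0)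
      (fun ω _ => by split_ifs <;> simp [hπ0])
      (Finset.mem_univ (fun _ => true : Judg p))
    simpa using h
  have hεa' : ε ≤ 1 - a := by
    rw [← hcompl]
    refine (hpos π hπ fun _ => false).trans ?_
    have h := Finset.single_le_sum (f := fun ω : Judg p => if ω i then 0 else π ω)
      (fun ω _ => by split_ifs <;> simp [hπ0])
      (Finset.mem_univ (fun _ => false : Judg p))
    simpa using h
  rw [hcompl]
  exact binomial_weight_le hn k hε hεa hεa'

end
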